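/- Fix a prime p and integers h ≥ 2 and 1 ≤ t ≤ h−1. Let W = 𝕎(𝔽_{p^h}) be the ring of p-typical Witt vectors of the field with p^h elements, let A = W⟦u_1,…,u_{h−1}⟧ be the formal power series ring over W in the h−1 variables u_1,…,u_{h−1}, let B be the localization of A away from u_t, let I_t be the ideal of B generated by the images of p, u_1, …, u_{t−1}, and let R be the I_t-adic completion of B. Then the images of p, u_1, …, u_{t−1} in R form a regular sequence on R, and the image of u_t in R is a unit. -/

import Mathlib

open RingTheory.Sequence in
/-- Membership in the ideal generated by a constant and the first `k` variables. -/
theorem LKt_mem_span_iff {W : Type*} [CommRing W] (c : W) (n k : ℕ)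
    (f : MvPowerSeries (Fin n) W) :
    f ∈ Ideal.span {x : MvPowerSeries (Fin n) W | x = MvPowerSeries.C c ∨
        ∃ i : Fin n, (i : ℕ) < k ∧ x = MvPowerSeries.X i} ↔
      ∀ m : Fin n →₀ ℕ, (∀ i : Fin n, (i : ℕ) < k → m i = 0) →
        c ∣ MvPowerSeries.coeff m f := by
  classical
  constructor
  · intro hf
    induction hf using Submodule.span_induction with
    | mem x hx =>
      intro m hm
      rcases hx with rfl | ⟨i, hi, rfl⟩
      · rw [MvPowerSeries.coeff_C]
        split_ifs <;> simp
      · rw [MvPowerSeries.coeff_X, if_neg]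
        · simp
        · rintro rfl
          simpa using hm i hi
    | zero => simp
    | add x y _ _ hx hy =>
      intro m hm
      rw [map_add]
      exact dvd_add (hx m hm) (hy m hm)
    | smul a x _ hx =>
      intro m hm
      rw [smul_eq_mul, MvPowerSeries.coeff_mul]
      refine Finset.dvd_sum fun q hq => Dvd.dvd.mul_left (hx _ fun i hi => ?_) _
      have h1 := hm i hi
      rw [← Finset.HasAntidiagonal.mem_antidiagonal.1 hq, Finsupp.add_apply] at h1
      omega
  · induction k generalizing f with
    | zero =>
      intro hf
      choose g hg using fun m => hf m (by simp)
      have : f = MvPowerSeries.C c * (show MvPowerSeries (Fin n) W from g) := by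
        ext m
        rw [MvPowerSeries.coeff_C_mul]
        exact hg m
      rw [this]
      exact Ideal.mul_mem_right _ _ (Ideal.subset_span (Or.inl rfl))
    | succ k ih =>
      intro hf
      have hmono : Ideal.span {x : MvPowerSeries (Fin n) W | x = MvPowerSeries.C c ∨
          ∃ i : Fin n, (i : ℕ) < k ∧ x = MvPowerSeries.X i} ≤
          Ideal.span {x : MvPowerSeries (Fin n) W | x = MvPowerSeries.C c ∨
          ∃ i : Fin n, (i : ℕ) < k + 1 ∧ x = MvPowerSeries.X i} := by
        apply Ideal.span_mono
        rintro x (hx | ⟨i, hi, hx⟩)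
        · exact Or.inl hx
        · exact Or.inr ⟨i, by omega, hx⟩
      by_cases hk : k < n
      · let j : Fin n := ⟨k, hk⟩
        let f0 : MvPowerSeries (Fin n) W := fun m => if m j = 0 then MvPowerSeries.coeff m f else 0
        let g : MvPowerSeries (Fin n) W :=
          fun m => MvPowerSeries.coeff (m + Finsupp.single j 1) f
        have hf0 : ∀ m, MvPowerSeries.coeff m f0 =
          if m j = 0 then MvPowerSeries.coeff m f else 0 := fun m => rfl
        have hg : ∀ m, MvPowerSeries.coeff m g =
          MvPowerSeries.coeff (m + Finsupp.single j 1) f := fun m => rfl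
        have hfe : f = f0 + g * MvPowerSeries.X j := by
          ext m
          rw [map_add, hf0, MvPowerSeries.X, MvPowerSeries.coeff_mul_monomial, mul_one, hg]
          by_cases hm : m j = 0
          · rw [if_pos hm, if_neg, add_zero]
            intro hle
            have := hle j
            simp [hm] at this
          · have hle : Finsupp.single j 1 ≤ m := by
              rw [Finsupp.single_le_iff]; omega
            rw [if_neg hm, if_pos hle, tsub_add_cancel_of_le hle, zero_add]
        rw [hfe]
        refine Ideal.add_mem _ (hmono (ih f0 fun m hm => ?_)) (Ideal.mul_mem_left _ _
          (Ideal.subset_span (Or.inr ⟨j, Nat.lt_succ_self k, rfl⟩)))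
        rw [hf0]
        split_ifs with hmj
        · refine hf m fun i hi => ?_
          rcases Nat.lt_succ_iff_lt_or_eq.1 hi with h1 | h1
          · exact hm i h1
          · have : i = j := Fin.ext h1
            rw [this, hmj]
        · exact dvd_zero _
      · refine hmono (ih f fun m hm => hf m fun i hi => hm i ?_)
        have := i.2
        omega

/-- The ideal of the list `c, X_0, …` truncated. -/
theorem LKt_ofList_take {W : Type*} [CommRing W] (c : W) (n k i : ℕ) (hk : k ≤ n) (hi : i ≤ k) :
    Ideal.ofList (MvPowerSeries.C c :: (List.ofFn fun j : Fin k =>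
      (MvPowerSeries.X ⟨(j : ℕ), by omega⟩ : MvPowerSeries (Fin n) W)).take i) =
    Ideal.span {x : MvPowerSeries (Fin n) W | x = MvPowerSeries.C c ∨
        ∃ j : Fin n, (j : ℕ) < i ∧ x = MvPowerSeries.X j} := by
  unfold Ideal.ofList
  congr 1
  ext x
  simp only [List.mem_cons, Set.mem_ofPred_eq, List.mem_take_iff_getElem, List.length_ofFn,
    List.getElem_ofFn]
  refine or_congr Iff.rfl ⟨?_, ?_⟩
  · rintro ⟨j, hj, rfl⟩
    exact ⟨⟨j, by omega⟩, by simp; omega, rfl⟩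
  · rintro ⟨j, hj, rfl⟩
    exact ⟨j, by omega, rfl⟩

open RingTheory.Sequence in
theorem LKt_weaklyRegular {W : Type*} [CommRing W] [IsDomain W] (c : W) (hc : c ≠ 0)
    (n k : ℕ) (hk : k ≤ n) :
    IsWeaklyRegular (MvPowerSeries (Fin n) W) (MvPowerSeries.C c :: List.ofFn fun j : Fin k =>
      (MvPowerSeries.X ⟨(j : ℕ), by omega⟩ : MvPowerSeries (Fin n) W)) := by
  classical
  constructor
  intro i hi
  rw [isSMulRegular_quotient_iff_mem_of_smul_mem]
  intro f
  rw [smul_eq_mul, smul_eq_mul, Ideal.mul_top]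
  cases i with
  | zero =>
    simp only [List.take_zero, Ideal.ofList_nil, List.getElem_cons_zero, Ideal.mem_bot]
    intro hf
    rcases mul_eq_zero.1 hf with h1 | h1
    · exact absurd ((map_eq_zero_iff _ (MvPowerSeries.C_injective)).1 h1) hc
    · exact h1
  | succ i =>
    have hik : i < k := by simpa using hi
    rw [List.take_succ_cons, LKt_ofList_take c n k i hk hik.le, LKt_mem_span_iff,
      LKt_mem_span_iff]
    simp only [List.getElem_cons_succ, List.getElem_ofFn]
    intro hf m hm
    have hin : i < n := by omega
    have h1 := hf (m + Finsupp.single (⟨i, hin⟩ : Fin n) 1) fun j hj => by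
      have hne : (⟨i, hin⟩ : Fin n) ≠ j := by
        rintro rfl
        simp at hj
      rw [Finsupp.add_apply, hm j hj, Finsupp.single_apply, if_neg hne, add_zero]
    rwa [add_comm, MvPowerSeries.X, MvPowerSeries.coeff_add_monomial_mul, one_mul] at h1

theorem LKt_X_pow_notMem {W : Type*} [CommRing W] (c : W) (hc : ¬ IsUnit c)
    (n k : ℕ) (j : Fin n) (hj : k ≤ (j : ℕ)) (N : ℕ) :
    (MvPowerSeries.X j : MvPowerSeries (Fin n) W) ^ N ∉
      Ideal.span {x : MvPowerSeries (Fin n) W | x = MvPowerSeries.C c ∨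
        ∃ i : Fin n, (i : ℕ) < k ∧ x = MvPowerSeries.X i} := by
  classical
  rw [LKt_mem_span_iff]
  intro H
  have h1 := H (Finsupp.single j N) fun i hi => by
    rw [Finsupp.single_apply, if_neg]
    rintro rfl
    omega
  rw [MvPowerSeries.coeff_X_pow, if_pos rfl] at h1
  exact hc (isUnit_of_dvd_one h1)

/-- Landweber flatness claim for `π₀ L_{K(t)} E_h`.  With
`A = 𝕎(𝔽_{p^h})⟦u_1, …, u_{h-1}⟧`, `B = u_t⁻¹ A` the localization away from
`u_t`, and `R` the completion of `B` at the ideal `I_t = (p, u_1, …, u_{t-1})`: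
the images of `p, u_1, …, u_{t-1}` in `R` form a regular sequence on `R`, and
the image of `u_t` in `R` is a unit. -/
theorem LKt_Eh_regular_sequence (p : ℕ) [Fact p.Prime] (h t : ℕ)
    (hh : 2 ≤ h) (ht1 : 1 ≤ t) (ht2 : t ≤ h - 1) :
    let A := MvPowerSeries (Fin (h - 1)) (WittVector p (GaloisField p h))
    let B := Localization.Away
      (MvPowerSeries.X (⟨t - 1, by omega⟩ : Fin (h - 1)) : A)
    let seq : List B := (p : B) :: List.ofFn fun i : Fin (t - 1) =>
      algebraMap A B (MvPowerSeries.X ⟨(i : ℕ), by omega⟩)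
    let It : Ideal B := Ideal.span {x | x ∈ seq}
    let R := AdicCompletion It B
    RingTheory.Sequence.IsRegular R (seq.map (algebraMap B R)) ∧
      IsUnit (algebraMap B R
        (algebraMap A B (MvPowerSeries.X (⟨t - 1, by omega⟩ : Fin (h - 1))))) := by
  intro A B seq It R
  have hlt : t - 1 < h - 1 := by omega
  let W := WittVector p (GaloisField p h)
  let l : List A := MvPowerSeries.C (p : W) :: List.ofFn fun j : Fin (t - 1) =>
      (MvPowerSeries.X ⟨(j : ℕ), by omega⟩ : MvPowerSeries (Fin (h - 1)) W)
  have hseq : seq = l.map (algebraMap A B) := by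
    simp only [seq, l, List.map_cons, List.map_ofFn]
    congr 1
    simp
  have hIt : It = Ideal.ofList seq := rfl
  have : IsNoetherianRing W := inferInstance
  have : IsNoetherianRing A := inferInstanceAs (IsNoetherianRing (MvPowerSeries (Fin (h - 1)) W))
  have : IsNoetherianRing B := IsLocalization.isNoetherianRing
    (Submonoid.powers (MvPowerSeries.X (⟨t - 1, hlt⟩ : Fin (h - 1)) : A)) B inferInstance
  have hlreg : RingTheory.Sequence.IsWeaklyRegular A l :=
    LKt_weaklyRegular (p : W) (WittVector.p_nonzero p _) (h - 1) (t - 1) (by omega)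
  have hBreg : RingTheory.Sequence.IsWeaklyRegular B seq := by
    rw [hseq]
    exact hlreg.of_isLocalization B
      (Submonoid.powers (MvPowerSeries.X (⟨t - 1, hlt⟩ : Fin (h - 1)) : A))
  have hItne : It ≠ ⊤ := by
    rw [hIt, hseq, ← Ideal.map_ofList]
    rw [IsLocalization.map_algebraMap_ne_top_iff_disjoint
      (Submonoid.powers (MvPowerSeries.X (⟨t - 1, hlt⟩ : Fin (h - 1)) : A)), Set.disjoint_left]
    rintro _ ⟨N, rfl⟩ hmem
    have hl := LKt_ofList_take (p : W) (h - 1) (t - 1) (t - 1) (by omega) le_rfl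
    rw [List.take_of_length_le (by simp)] at hl
    refine LKt_X_pow_notMem (p : W) (WittVector.irreducible p).not_isUnit (h - 1) (t - 1)
      ⟨t - 1, hlt⟩ le_rfl N ?_
    rw [← hl]
    exact hmem
  refine ⟨⟨hBreg.of_flat, ?_⟩, ?_⟩
  · intro htop
    rw [← Ideal.map_ofList, ← hIt, smul_eq_mul, Ideal.mul_top] at htop
    apply hItne
    have h1 : (1 : R) ∈ It.map (algebraMap B R) := htop ▸ Submodule.mem_top
    have h2 : It.map (algebraMap B R) ≤ RingHom.ker (AdicCompletion.evalOneₐ It) := by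
      rw [Ideal.map_le_iff_le_comap]
      intro x hx
      rw [Ideal.mem_comap, RingHom.mem_ker, AlgHom.commutes]
      exact Ideal.Quotient.eq_zero_iff_mem.2 hx
    have h3 := h2 h1
    rw [RingHom.mem_ker, map_one] at h3
    rw [Ideal.eq_top_iff_one]
    exact Ideal.Quotient.eq_zero_iff_mem.1 h3
  · exact (IsLocalization.Away.algebraMap_isUnit _).map _
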